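/- arXiv:2008.13011 — 3 statements merged into one kernel-verified Lean document; each statement's English description precedes it below -/
import Mathlib

section
/- Let P₁(t) = a_{σ₁}t^{σ₁} + ⋯ + a_{d₁}t^{d₁} and P₂(t) = b_{σ₂}t^{σ₂} + ⋯ + b_{d₂}t^{d₂} be real polynomials with a_{σ₁}, a_{d₁}, b_{σ₂}, b_{d₂} ≠ 0, P₁(0) = P₂(0) = 0 and 1 ≤ deg P₁ = d₁ < deg P₂ = d₂. Let τ be a nonnegative smooth function on ℝ supported in [1/2, 2] with ∫τ = 1. For nonnegative integers j, l, m and an integer k, set m₀ = log₂(|b_{d₂}|/|a_{d₁}|) + (d₂ − d₁)(j − l) and define K(ξ, η) = ∫_ℝ τ(t) · e(2^{m − jd₂}(2^{m₀ + k} P₁(2^{j−l} t) ξ + P₂(2^{j−l} t) η)) dt. Then for every 𝒦 > 0 there exist a constant C₄ > 2, Γ₁ ∈ ℕ and C > 0, depending only on P₁, P₂, τ and 𝒦, such that for all nonnegative integers j, l with j − l ≥ Γ₁, all m ∈ ℤ≥0, all integers k with |k| < 𝒦, and all real ξ, η with |ξ| ∉ [C₄^{−1}, C₄] and 1 ≤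 |η| ≤ 2, one has |K(ξ, η)| ≤ C · 2^{d₂ l} · 2^{−m}. -/
open MeasureTheory Polynomial

/-- `e(x) = exp(2πix)`. -/
noncomputable def expi (x : ℝ) : ℂ := Complex.exp (2 * Real.pi * Complex.I * x)

theorem norm_expi (x : ℝ) : ‖expi x‖ = 1 := by
  have h : (2 * Real.pi * Complex.I * x : ℂ) = ((2 * Real.pi * x : ℝ) : ℂ) * Complex.I := by
    push_cast; ring
  rw [expi, h, Complex.norm_exp_ofReal_mul_I]

theorem continuous_expi : Continuous expi := by
  unfold expi; fun_prop

theorem hasDerivAt_expi_comp {f : ℝ → ℝ} {f' x : ℝ} (hf : HasDerivAt f f' x) :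
    HasDerivAt (fun t => expi (f t)) (2 * Real.pi * Complex.I * f' * expi (f x)) x := by
  have h := (hf.ofReal_comp.const_mul (2 * Real.pi * Complex.I : ℂ)).cexp
  refine h.congr_deriv ?_
  unfold expi
  ring

/-- A continuous function supported in `[a, b]` vanishes at the endpoints. -/
theorem eq_zero_endpoints_of_support_subset_Icc {τ : ℝ → ℝ} (hτ : Continuous τ) {a b : ℝ}
    (hsupp : Function.support τ ⊆ Set.Icc a b) : τ a = 0 ∧ τ b = 0 := by
  have hopen : IsOpen (Function.support τ) := hτ.isOpen_support
  have hsub : Function.support τ ⊆ Set.Ioo a b := by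
    rw [← interior_Icc]; exact interior_maximal hsupp hopen
  constructor
  · by_contra h
    exact lt_irrefl _ (hsub (Function.mem_support.mpr h)).1
  · by_contra h
    exact lt_irrefl _ (hsub (Function.mem_support.mpr h)).2

/-- The non-stationary phase estimate obtained from one integration by parts. -/
theorem norm_integral_mul_expi_le {τ : ℝ → ℝ} (hτ : ContDiff ℝ 1 τ) {a b : ℝ} (hab : a ≤ b)
    (hsupp : Function.support τ ⊆ Set.Icc a b) {T : ℝ}
    (hT : ∀ t ∈ Set.Icc a b, |τ t| ≤ T) (hT' : ∀ t ∈ Set.Icc a b, |deriv τ t| ≤ T)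
    (F : ℝ[X]) {B D : ℝ} (hB : 0 < B)
    (hF : ∀ t ∈ Set.Icc a b, B ≤ |F.derivative.eval t|)
    (hF' : ∀ t ∈ Set.Icc a b, |F.derivative.derivative.eval t| ≤ D * |F.derivative.eval t|) :
    ‖∫ t : ℝ, (τ t : ℂ) * expi (F.eval t)‖ ≤ T * (1 + D) / B * (b - a) := by
  have hT0 : 0 ≤ T := (abs_nonneg _).trans (hT a ⟨le_rfl, hab⟩)
  obtain ⟨hτa, hτb⟩ := eq_zero_endpoints_of_support_subset_Icc hτ.continuous hsupp
  have hne : ∀ t ∈ Set.Icc a b, F.derivative.eval t ≠ 0 := fun t ht h => by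
    have := hF t ht
    rw [h, abs_zero] at this
    exact absurd this (not_le.mpr hB)
  have hpi : (2 * Real.pi * Complex.I : ℂ) ≠ 0 := Complex.two_pi_I_ne_zero
  set g' : ℝ → ℝ := fun t => (deriv τ t * F.derivative.eval t -
    τ t * F.derivative.derivative.eval t) / F.derivative.eval t ^ 2 with hg'
  have hg : ∀ t ∈ Set.Icc a b,
      HasDerivAt (fun t => ((τ t / F.derivative.eval t : ℝ) : ℂ)) (g' t : ℂ) t := fun t ht =>
    (((hτ.differentiable one_ne_zero t).hasDerivAt).div (F.derivative.hasDerivAt t)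
      (hne t ht)).ofReal_comp
  have hcg' : ContinuousOn g' (Set.Icc a b) := by
    have h1 : Continuous (deriv τ) := hτ.continuous_deriv le_rfl
    have h2 := hτ.continuous
    refine ContinuousOn.div (by fun_prop) (by fun_prop) fun t ht => pow_ne_zero 2 (hne t ht)
  have hu : Set.uIcc a b = Set.Icc a b := Set.uIcc_of_le hab
  have hce : Continuous fun t => expi (F.eval t) := continuous_expi.comp F.continuous
  have hparts := intervalIntegral.integral_mul_deriv_eq_deriv_mul (a := a) (b := b)
    (u := fun t => ((τ t / F.derivative.eval t : ℝ) : ℂ)) (v := fun t => expi (F.eval t))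
    (u' := fun t => (g' t : ℂ))
    (v' := fun t => 2 * Real.pi * Complex.I * (F.derivative.eval t : ℝ) * expi (F.eval t))
    (fun t ht => hg t (hu ▸ ht)) (fun t _ => hasDerivAt_expi_comp (F.hasDerivAt t))
    (ContinuousOn.intervalIntegrable
      (by rw [hu]; exact Complex.continuous_ofReal.comp_continuousOn hcg'))
    (Continuous.intervalIntegrable
      (((continuous_const.mul (Complex.continuous_ofReal.comp F.derivative.continuous))).mul hce)
      _ _)
  have hleft : (∫ t in a..b, ((τ t / F.derivative.eval t : ℝ) : ℂ) *
      (2 * Real.pi * Complex.I * (F.derivative.eval t : ℝ) * expi (F.eval t))) =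
      (2 * Real.pi * Complex.I) * ∫ t : ℝ, (τ t : ℂ) * expi (F.eval t) := by
    have h1 : ∫ t : ℝ, (τ t : ℂ) * expi (F.eval t) =
        ∫ t in a..b, (τ t : ℂ) * expi (F.eval t) := by
      rw [intervalIntegral.integral_of_le hab, ← integral_Icc_eq_integral_Ioc]
      symm
      apply setIntegral_eq_integral_of_forall_compl_eq_zero
      intro t ht
      have : τ t = 0 := by
        by_contra h
        exact ht (hsupp h)
      simp [this]
    rw [h1, ← intervalIntegral.integral_const_mul]
    refine intervalIntegral.integral_congr fun t ht => ?_
    have h0 : ((F.derivative.eval t : ℝ) : ℂ) ≠ 0 := by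
      exact_mod_cast hne t (hu ▸ ht)
    push_cast
    field_simp
  rw [hleft] at hparts
  simp only [hτa, hτb, zero_div, Complex.ofReal_zero, zero_mul, sub_zero, zero_sub] at hparts
  have hbound : ‖∫ t in a..b, (g' t : ℂ) * expi (F.eval t)‖ ≤
      T * (1 + D) / B * |b - a| := by
    refine intervalIntegral.norm_integral_le_of_norm_le_const fun t ht => ?_
    have ht' : t ∈ Set.Icc a b := by
      rw [Set.uIoc_of_le hab] at ht; exact ⟨ht.1.le, ht.2⟩
    have hp : 0 < |F.derivative.eval t| := abs_pos.mpr (hne t ht')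
    rw [norm_mul, norm_expi, mul_one, Complex.norm_real, Real.norm_eq_abs, hg', abs_div, abs_pow]
    have hD : 0 ≤ D := by
      have := (abs_nonneg _).trans (hF' t ht')
      exact nonneg_of_mul_nonneg_left this hp
    have hnum : |deriv τ t * F.derivative.eval t - τ t * F.derivative.derivative.eval t| ≤
        T * (1 + D) * |F.derivative.eval t| := by
      refine (abs_sub _ _).trans ?_
      rw [abs_mul, abs_mul]
      have h1 := mul_le_mul_of_nonneg_right (hT' t ht') hp.le
      have h2 := mul_le_mul (hT t ht') (hF' t ht') (abs_nonneg _) hT0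
      linarith
    calc _ ≤ T * (1 + D) * |F.derivative.eval t| / |F.derivative.eval t| ^ 2 := by gcongr
      _ = T * (1 + D) / |F.derivative.eval t| := by field_simp
      _ ≤ T * (1 + D) / B := by
        have := hF t ht'
        gcongr
  have hnorm := congrArg norm hparts
  rw [norm_mul, norm_neg] at hnorm
  rw [abs_of_nonneg (sub_nonneg.mpr hab)] at hbound
  have h2pi : (1 : ℝ) ≤ ‖(2 * Real.pi * Complex.I : ℂ)‖ := by
    simp only [norm_mul, Complex.norm_I, Complex.norm_real, Real.norm_eq_abs,
      abs_of_pos Real.pi_pos, Complex.norm_ofNat, mul_one]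
    linarith [Real.pi_gt_three]
  calc _ ≤ ‖(2 * Real.pi * Complex.I : ℂ)‖ * ‖∫ t : ℝ, (τ t : ℂ) * expi (F.eval t)‖ :=
        le_mul_of_one_le_left (norm_nonneg _) h2pi
    _ ≤ _ := hnorm ▸ hbound

/-- The rescaled polynomial `r⁻ᵈ P(rt)` of degree `d` has, uniformly in large `r` and
`t ∈ [1/2, 2]`, first derivative bounded above and below and second derivative bounded above. -/
theorem exists_rescaled_derivative_bounds (P : ℝ[X]) (hd : 1 ≤ P.natDegree) :
    ∃ c M R : ℝ, 0 < c ∧ c ≤ M ∧ ∀ r : ℝ, R ≤ r → ∀ t ∈ Set.Icc (1 / 2 : ℝ) 2,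
      c * r ^ P.natDegree ≤ |r * P.derivative.eval (r * t)| ∧
      |r * P.derivative.eval (r * t)| ≤ M * r ^ P.natDegree ∧
      |r ^ 2 * P.derivative.derivative.eval (r * t)| ≤ M * r ^ P.natDegree := by
  set d := P.natDegree with hdd
  have hP' : P.derivative.natDegree = d - 1 := natDegree_derivative P
  have hP'0 : P.derivative ≠ 0 := by
    intro h
    have := derivative_eq_zero.mp h
    omega
  have hdeg1 : (X * P.derivative).degree = (X ^ d : ℝ[X]).degree := by
    rw [degree_mul, degree_X, degree_X_pow, degree_eq_natDegree hP'0, hP']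
    norm_cast
    omega
  have hdeg2 : (X ^ 2 * P.derivative.derivative).degree ≤ (X ^ d : ℝ[X]).degree := by
    rw [← hdeg1, pow_two, mul_assoc, degree_mul, degree_mul (p := X) (q := P.derivative)]
    gcongr
    by_cases h : P.derivative.derivative = 0
    · simp [h]
    rw [degree_mul, degree_X, add_comm]
    exact Nat.WithBot.add_one_le_of_lt (degree_derivative_lt hP'0)
  obtain ⟨c₁, hc₁, h1⟩ := (isBigO_atTop_of_degree_le _ _ hdeg1.ge).exists_pos
  obtain ⟨c₂, hc₂, h2⟩ := (isBigO_atTop_of_degree_le _ _ hdeg1.le).exists_pos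
  obtain ⟨c₃, hc₃, h3⟩ := (isBigO_atTop_of_degree_le _ _ hdeg2).exists_pos
  obtain ⟨R, hR⟩ := Filter.eventually_atTop.mp (h1.bound.and (h2.bound.and h3.bound))
  simp only [eval_mul, eval_X, eval_pow, Real.norm_eq_abs] at hR
  have key : c₁⁻¹ * (1 / 2) ^ d / 2 ≤ c₁⁻¹ * (1 / 2) ^ d / 2 + (c₂ + 2 * c₃) * 2 ^ d * 2 := by
    have : 0 ≤ (c₂ + 2 * c₃) * 2 ^ d * 2 := by positivity
    linarith
  refine ⟨c₁⁻¹ * (1 / 2) ^ d / 2, c₁⁻¹ * (1 / 2) ^ d / 2 + (c₂ + 2 * c₃) * 2 ^ d * 2,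
    max 1 (2 * R), by positivity, key, ?_⟩
  rintro r hr t ⟨ht1, ht2⟩
  have hr1 : 1 ≤ r := (le_max_left _ _).trans hr
  have hr2 : 2 * R ≤ r := (le_max_right _ _).trans hr
  have ht0 : 0 < t := by linarith
  have hr0 : 0 < r := by linarith
  obtain ⟨e1, e2, e3⟩ := hR (r * t) (by nlinarith)
  set p := P.derivative.eval (r * t)
  set q := P.derivative.derivative.eval (r * t)
  have hx : |(r * t) ^ d| = r ^ d * t ^ d := by rw [abs_of_pos (by positivity), mul_pow]
  rw [hx] at e1 e2 e3
  have a1 : |r * t * p| = t * |r * p| := by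
    rw [mul_right_comm, abs_mul, abs_of_pos ht0, mul_comm]
  have a2 : |(r * t) ^ 2 * q| = t ^ 2 * |r ^ 2 * q| := by
    rw [mul_pow, mul_right_comm, abs_mul, abs_of_pos (show 0 < t ^ 2 by positivity), mul_comm]
  rw [a1] at e1 e2
  rw [a2] at e3
  have hrd : 0 < r ^ d := by positivity
  have tl : (1 / 2 : ℝ) ^ d ≤ t ^ d := by gcongr
  have tu : t ^ d ≤ 2 ^ d := by gcongr
  have hu : ∀ c, 0 < c → c * (r ^ d * t ^ d) ≤ c * 2 ^ d * r ^ d := fun c hc => by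
    calc c * (r ^ d * t ^ d) ≤ c * (r ^ d * 2 ^ d) := by gcongr
      _ = _ := by ring
  have u2 := hu c₂ hc₂
  have u3 := hu c₃ hc₃
  have z1 : 0 ≤ c₁⁻¹ * (1 / 2) ^ d / 2 * r ^ d := by positivity
  have z2 : 0 ≤ c₂ * 2 ^ d * r ^ d := by positivity
  have z3 : 0 ≤ c₃ * 2 ^ d * r ^ d := by positivity
  have n1 := abs_nonneg (r * p)
  have n2 := abs_nonneg (r ^ 2 * q)
  refine ⟨?_, ?_, ?_⟩
  · have h5 : r ^ d * (1 / 2) ^ d ≤ c₁ * (2 * |r * p|) := by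
      calc r ^ d * (1 / 2) ^ d ≤ r ^ d * t ^ d := by gcongr
        _ ≤ c₁ * (t * |r * p|) := e1
        _ ≤ _ := by gcongr
    calc c₁⁻¹ * (1 / 2) ^ d / 2 * r ^ d = c₁⁻¹ * (r ^ d * (1 / 2) ^ d) / 2 := by ring
      _ ≤ c₁⁻¹ * (c₁ * (2 * |r * p|)) / 2 := by gcongr
      _ = |r * p| := by field_simp
  · have : 1 / 2 * |r * p| ≤ t * |r * p| := by gcongr
    nlinarith
  · have : (1 / 2) ^ 2 * |r ^ 2 * q| ≤ t ^ 2 * |r ^ 2 * q| := by gcongr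
    nlinarith

/-- If `|x|` is either much smaller or much larger than `1`, then `x p + y q` does not suffer
cancellation, and it dominates the corresponding combination `x p' + y q'`. -/
theorem no_cancellation {c₁ M₁ c₂ M₂ x y p q p' q' : ℝ} (hc₁ : 0 < c₁) (hc₂ : 0 < c₂)
    (hcM₁ : c₁ ≤ M₁) (hcM₂ : c₂ ≤ M₂)
    (hp : c₁ ≤ |p|) (hpM : |p| ≤ M₁) (hp' : |p'| ≤ M₁)
    (hq : c₂ ≤ |q|) (hqM : |q| ≤ M₂) (hq' : |q'| ≤ M₂) (hy : 1 ≤ |y|) (hy' : |y| ≤ 2)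
    (hx : M₁ * |x| ≤ c₂ / 2 ∨ 4 * M₂ ≤ c₁ * |x|) :
    c₂ / 2 ≤ |x * p + y * q| ∧
      |x * p' + y * q'| ≤ (2 + 2 * M₁ / c₁ + 4 * M₂ / c₂) * |x * p + y * q| := by
  have b1 : |x * p' + y * q'| ≤ |x| * M₁ + 2 * M₂ := by
    refine (abs_add_le _ _).trans ?_
    rw [abs_mul, abs_mul]
    gcongr
  have hM₁ : 0 < M₁ := by linarith
  have hM₂ : 0 < M₂ := by linarith
  have hxp : |x * p| = |x| * |p| := abs_mul _ _
  have hyq : |y * q| = |y| * |q| := abs_mul _ _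
  have l1 : |y * q| - |x * p| ≤ |x * p + y * q| := by
    have := abs_sub_abs_le_abs_sub (y * q) (-(x * p))
    rwa [abs_neg, show y * q - -(x * p) = x * p + y * q by ring] at this
  have l2 : |x * p| - |y * q| ≤ |x * p + y * q| := by
    have := abs_sub_abs_le_abs_sub (x * p) (-(y * q))
    rwa [abs_neg, sub_neg_eq_add] at this
  have x1 : |x| * |p| ≤ |x| * M₁ := by gcongr
  have x2 : |x| * c₁ ≤ |x| * |p| := by gcongr
  have y1 : 1 * c₂ ≤ |y| * |q| := by gcongr
  have y2 : |y| * |q| ≤ 2 * M₂ := by gcongr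
  set N := |x * p + y * q|
  have hN : 0 ≤ N := abs_nonneg _
  have t1 : 0 ≤ 2 * M₁ / c₁ * N := by positivity
  have t2 : 0 ≤ 4 * M₂ / c₂ * N := by positivity
  rcases hx with hx | hx
  · have h1 : c₂ / 2 ≤ N := by linarith
    refine ⟨h1, ?_⟩
    have : 2 * M₂ ≤ 4 * M₂ / c₂ * N := by
      calc 2 * M₂ = 4 * M₂ / c₂ * (c₂ / 2) := by field_simp; ring
        _ ≤ _ := by gcongr
    linarith
  · have h1 : c₁ * |x| / 2 ≤ N := by linarith
    refine ⟨by linarith, ?_⟩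
    have : |x| * M₁ ≤ 2 * M₁ / c₁ * N := by
      calc |x| * M₁ = 2 * M₁ / c₁ * (c₁ * |x| / 2) := by field_simp
        _ ≤ _ := by gcongr
    linarith

/-- the kernel bound (4.19), regime `j − l ≥ Γ₁`.  Here `σ₁, σ₂` are the
lowest degrees, `d₁ = deg P₁ < d₂ = deg P₂`,
`m₀ = log₂(|b_{d₂}|/|a_{d₁}|) + (d₂−d₁)(j−l)`, and
`K(ξ,η) = ∫ τ(t) e(2^{m−jd₂}(2^{m₀+k}P₁(2^{j−l}t)ξ + P₂(2^{j−l}t)η)) dt`.  If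
`|ξ| ∉ [C₄⁻¹, C₄]` and `1 ≤ |η| ≤ 2` then `|K(ξ,η)| ≤ C · 2^{d₂l} · 2^{−m}`. -/
theorem stmt9 (σ₁ d₁ σ₂ d₂ : ℕ) (P₁ P₂ : Polynomial ℝ)
    (htr₁ : P₁.natTrailingDegree = σ₁) (hde₁ : P₁.natDegree = d₁)
    (htr₂ : P₂.natTrailingDegree = σ₂) (hde₂ : P₂.natDegree = d₂)
    (haσ : P₁.coeff σ₁ ≠ 0) (had : P₁.coeff d₁ ≠ 0)
    (hbσ : P₂.coeff σ₂ ≠ 0) (hbd : P₂.coeff d₂ ≠ 0)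
    (h01 : P₁.eval 0 = 0) (h02 : P₂.eval 0 = 0)
    (hd₁pos : 1 ≤ d₁) (hd₁₂ : d₁ < d₂)
    (τ : ℝ → ℝ) (hτsmooth : ContDiff ℝ (⊤ : ℕ∞) τ) (hτnonneg : ∀ t, 0 ≤ τ t)
    (hτsupp : Function.support τ ⊆ Set.Icc (1/2 : ℝ) 2) (hτint : ∫ t, τ t = 1)
    (𝒦 : ℝ) (h𝒦 : 0 < 𝒦) :
    ∃ C₄ : ℝ, 2 < C₄ ∧ ∃ Γ₁ : ℕ, 0 < Γ₁ ∧ ∃ C : ℝ, 0 < C ∧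
      ∀ j l : ℕ, (Γ₁ : ℤ) ≤ (j : ℤ) - (l : ℤ) → ∀ m : ℕ, ∀ k : ℤ, |(k : ℝ)| < 𝒦 →
      ∀ m₀ : ℝ,
        m₀ = Real.logb 2 (|P₂.coeff d₂| / |P₁.coeff d₁|) +
              ((d₂ : ℝ) - (d₁ : ℝ)) * ((j : ℝ) - (l : ℝ)) →
      ∀ K : ℝ → ℝ → ℂ,
        (∀ ξ η : ℝ, K ξ η = ∫ t : ℝ, (τ t : ℂ) *
          expi ((2:ℝ) ^ ((m : ℝ) - (j : ℝ) * (d₂ : ℝ)) *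
            ((2:ℝ) ^ (m₀ + (k : ℝ)) * P₁.eval ((2:ℝ) ^ ((j : ℝ) - (l : ℝ)) * t) * ξ +
              P₂.eval ((2:ℝ) ^ ((j : ℝ) - (l : ℝ)) * t) * η))) →
      ∀ ξ η : ℝ, |ξ| ∉ Set.Icc C₄⁻¹ C₄ → 1 ≤ |η| → |η| ≤ 2 →
        ‖K ξ η‖ ≤ C * (2:ℝ) ^ (d₂ * l) * (2:ℝ) ^ (-(m : ℝ)) := by
  subst hde₁ hde₂
  obtain ⟨c₁, M₁, R₁, hc₁, hcM₁, H₁⟩ := exists_rescaled_derivative_bounds P₁ hd₁pos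
  obtain ⟨c₂, M₂, R₂, hc₂, hcM₂, H₂⟩ :=
    exists_rescaled_derivative_bounds P₂ (hd₁pos.trans hd₁₂.le)
  have hτ1 : ContDiff ℝ 1 τ := hτsmooth.of_le (by exact_mod_cast le_top)
  obtain ⟨T₁, hT₁⟩ := (isCompact_Icc (a := (1 / 2 : ℝ)) (b := 2)).exists_bound_of_continuousOn
    hτ1.continuous.continuousOn
  obtain ⟨T₂, hT₂⟩ := (isCompact_Icc (a := (1 / 2 : ℝ)) (b := 2)).exists_bound_of_continuousOn
    (hτ1.continuous_deriv le_rfl).continuousOn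
  obtain ⟨n, hn⟩ := pow_unbounded_of_one_lt (max R₁ R₂) (one_lt_two (α := ℝ))
  have hM₁ : 0 < M₁ := hc₁.trans_le hcM₁
  have hM₂ : 0 < M₂ := hc₂.trans_le hcM₂
  set d₁ := P₁.natDegree
  set d₂ := P₂.natDegree
  set ρ := |P₂.coeff d₂| / |P₁.coeff d₁|
  have hρ : 0 < ρ := div_pos (abs_pos.mpr hbd) (abs_pos.mpr had)
  set T := max 1 (max T₁ T₂)
  have hT0 : 0 < T := zero_lt_one.trans_le (le_max_left _ _)
  set D := 2 + 2 * M₁ / c₁ + 4 * M₂ / c₂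
  have hD0 : 0 < D := by positivity
  set Ahi := ρ * (2 : ℝ) ^ 𝒦
  set Alo := ρ * (2 : ℝ) ^ (-𝒦)
  have hAhi : 0 < Ahi := by positivity
  have hAlo : 0 < Alo := by positivity
  have hE₁ : 0 < 2 * Ahi * M₁ / c₂ := by positivity
  have hE₂ : 0 < 4 * M₂ / (Alo * c₁) := by positivity
  refine ⟨3 + 2 * Ahi * M₁ / c₂ + 4 * M₂ / (Alo * c₁), by linarith, n + 1, n.succ_pos,
    T * (1 + D) / (c₂ / 2) * (2 - 1 / 2), by norm_num; positivity, ?_⟩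
  intro j l hjl m k hk m₀ hm₀ K hK ξ η hξ hη hη'
  set C₄ := 3 + 2 * Ahi * M₁ / c₂ + 4 * M₂ / (Alo * c₁)
  have hC₄0 : 0 < C₄ := by positivity
  set r : ℝ := (2 : ℝ) ^ ((j : ℝ) - (l : ℝ)) with hr
  have hr0 : 0 < r := by positivity
  have hRr : max R₁ R₂ ≤ r := by
    refine hn.le.trans ?_
    rw [hr, ← Real.rpow_natCast]
    refine Real.rpow_le_rpow_of_exponent_le one_le_two ?_
    have : ((n : ℤ) : ℝ) ≤ (((j : ℤ) - (l : ℤ) : ℤ) : ℝ) := by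
      exact_mod_cast (by push_cast at hjl; linarith : (n : ℤ) ≤ (j : ℤ) - (l : ℤ))
    push_cast at this
    exact this
  set A : ℝ := ρ * (2 : ℝ) ^ (k : ℝ) with hA
  have hA0 : 0 < A := by positivity
  obtain ⟨hk1, hk2⟩ := abs_lt.mp hk
  have hAle : A ≤ Ahi :=
    mul_le_mul_of_nonneg_left (Real.rpow_le_rpow_of_exponent_le one_le_two hk2.le) hρ.le
  have hleA : Alo ≤ A :=
    mul_le_mul_of_nonneg_left (Real.rpow_le_rpow_of_exponent_le one_le_two hk1.le) hρ.le
  set α : ℝ := (2 : ℝ) ^ ((m : ℝ) - (j : ℝ) * (d₂ : ℝ)) with hα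
  set β : ℝ := (2 : ℝ) ^ (m₀ + (k : ℝ)) with hβ
  set L : ℝ := (2 : ℝ) ^ ((m : ℝ) - (l : ℝ) * (d₂ : ℝ)) with hL
  have hL0 : 0 < L := by positivity
  have hαL : α * r ^ d₂ = L := by
    rw [hα, hr, hL, ← Real.rpow_mul_natCast zero_le_two, ← Real.rpow_add zero_lt_two]
    congr 1; ring
  have hβA : β * r ^ d₁ = A * r ^ d₂ := by
    rw [hβ, hA, hm₀, hr, ← Real.rpow_mul_natCast zero_le_two,
      ← Real.rpow_mul_natCast zero_le_two, Real.rpow_add zero_lt_two, Real.rpow_add zero_lt_two,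
      Real.rpow_logb zero_lt_two (by norm_num) hρ, mul_assoc, mul_assoc, mul_assoc,
      ← Real.rpow_add zero_lt_two, ← Real.rpow_add zero_lt_two, ← Real.rpow_add zero_lt_two]
    congr 2; ring
  have hLinv : (2 : ℝ) ^ (d₂ * l) * (2 : ℝ) ^ (-(m : ℝ)) = L⁻¹ := by
    rw [hL, ← Real.rpow_neg zero_le_two, ← Real.rpow_natCast, ← Real.rpow_add zero_lt_two]
    congr 1; push_cast; ring
  have hx : M₁ * |A * ξ| ≤ c₂ / 2 ∨ 4 * M₂ ≤ c₁ * |A * ξ| := by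
    rw [abs_mul, abs_of_pos hA0]
    rw [Set.mem_Icc, not_and_or, not_le, not_le] at hξ
    rcases hξ with hξ | hξ
    · left
      calc M₁ * (A * |ξ|) ≤ M₁ * (Ahi * C₄⁻¹) := by gcongr
        _ = (2 * Ahi * M₁ / c₂) * C₄⁻¹ * (c₂ / 2) := by field_simp
        _ ≤ C₄ * C₄⁻¹ * (c₂ / 2) := by gcongr; linarith
        _ = c₂ / 2 := by field_simp
    · right
      calc 4 * M₂ = c₁ * (Alo * (4 * M₂ / (Alo * c₁))) := by field_simp
        _ ≤ c₁ * (A * |ξ|) := by gcongr; linarith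
  set F : ℝ[X] := C α * (C β * P₁.comp (C r * X) * C ξ + P₂.comp (C r * X) * C η) with hF
  have hFe : ∀ t, F.eval t = α * (β * P₁.eval (r * t) * ξ + P₂.eval (r * t) * η) := by
    intro t; simp [hF]
  have hF1 : ∀ t, F.derivative.eval t = L * (A * ξ * (r * P₁.derivative.eval (r * t) / r ^ d₁) +
      η * (r * P₂.derivative.eval (r * t) / r ^ d₂)) := by
    intro t
    have e : A = β * r ^ d₁ / r ^ d₂ := by rw [hβA]; field_simp
    rw [← hαL, e]
    simp only [hF, derivative_mul, derivative_add, derivative_comp, derivative_C, derivative_X,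
      eval_mul, eval_add, eval_C, eval_X, eval_comp, eval_zero, eval_one]
    field_simp
    ring
  have hF2 : ∀ t, F.derivative.derivative.eval t =
      L * (A * ξ * (r ^ 2 * P₁.derivative.derivative.eval (r * t) / r ^ d₁) +
        η * (r ^ 2 * P₂.derivative.derivative.eval (r * t) / r ^ d₂)) := by
    intro t
    have e : A = β * r ^ d₁ / r ^ d₂ := by rw [hβA]; field_simp
    rw [← hαL, e]
    simp only [hF, derivative_mul, derivative_add, derivative_comp, derivative_C, derivative_X,
      eval_mul, eval_add, eval_C, eval_X, eval_comp, eval_zero, eval_one, derivative_zero,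
      derivative_one]
    field_simp
    ring
  have hphase : ∀ t ∈ Set.Icc (1 / 2 : ℝ) 2, L * (c₂ / 2) ≤ |F.derivative.eval t| ∧
      |F.derivative.derivative.eval t| ≤ D * |F.derivative.eval t| := by
    intro t ht
    obtain ⟨p1, p2, p3⟩ := H₁ r ((le_max_left _ _).trans hRr) t ht
    obtain ⟨q1, q2, q3⟩ := H₂ r ((le_max_right _ _).trans hRr) t ht
    have hr1 : 0 < r ^ d₁ := by positivity
    have hr2 : 0 < r ^ d₂ := by positivity
    rw [← le_div_iff₀ hr1] at p1
    rw [← le_div_iff₀ hr2] at q1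
    rw [← div_le_iff₀ hr1] at p2 p3
    rw [← div_le_iff₀ hr2] at q2 q3
    have hdiv : ∀ (x : ℝ) (d : ℕ), |x| / r ^ d = |x / r ^ d| := fun x d => by
      rw [abs_div, abs_of_pos (pow_pos hr0 d)]
    rw [hdiv] at p1 p2 p3 q1 q2 q3
    obtain ⟨h1, h2⟩ := no_cancellation hc₁ hc₂ hcM₁ hcM₂ p1 p2 p3 q1 q2 q3 hη hη' hx
    rw [hF1, hF2, abs_mul, abs_mul, abs_of_pos hL0]
    refine ⟨by gcongr, ?_⟩
    calc _ ≤ L * (D * _) := mul_le_mul_of_nonneg_left h2 hL0.le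
      _ = _ := by ring
  have hmain := norm_integral_mul_expi_le hτ1 (by norm_num) hτsupp (T := T)
    (fun t ht => (hT₁ t ht).trans ((le_max_left _ _).trans (le_max_right _ _)))
    (fun t ht => (hT₂ t ht).trans ((le_max_right _ _).trans (le_max_right _ _)))
    F (B := L * (c₂ / 2)) (by positivity) (fun t ht => (hphase t ht).1)
    (fun t ht => (hphase t ht).2)
  simp only [hFe] at hmain
  rw [hK, mul_assoc _ ((2 : ℝ) ^ (d₂ * l)), hLinv]
  refine hmain.trans (le_of_eq ?_)
  field_simp
end

section
/- Let P₁ and P₂ be linearly independent real polynomials with P₁(0) = P₂(0) = 0 whose lowest-degree terms have the same degree σ ≥ 1; write P₁(t) = a_σ t^σ + (terms of degree > σ) and P₂(t) = b_σ t^σ + (terms of degree > σ) with a_σ ≠ 0 and b_σ ≠ 0. Let ρ be the degree of the lowest-degree term of the nonzero polynomial P₂ − (b_σ/a_σ)P₁, and let c_ρ ≠ 0 be its coefficient (so ρ > σ). Then the polynomial P₁′P₂″ − P₁″P₂′ is not identically zero; more precisely, its lowest-degree term is σ·ρ·(ρ−σ)·a_σ·c_ρ·t^{σ+ρ−3}.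 -/
open Polynomial

namespace Polynomial

theorem X_mul_derivative_X_pow_mul {R : Type*} [CommRing R] (n : ℕ) (A : R[X]) :
    X * derivative (X ^ n * A) = X ^ n * (C (n : R) * A + X * derivative A) := by
  cases n with
  | zero => simp
  | succ n =>
    simp only [derivative_mul, derivative_X_pow, Nat.add_sub_cancel]
    ring

theorem exists_eq_X_pow_natTrailingDegree_mul {R : Type*} [CommRing R] (P : R[X]) :
    ∃ A : R[X], P = X ^ P.natTrailingDegree * A :=
  X_pow_dvd_iff.2 fun _ hd => coeff_eq_zero_of_lt_natTrailingDegree hd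

/-- The Wronskian of the derivatives of `X ^ m * A` and `X ^ n * B` is divisible by
`X ^ (m + n - 3)`, with an explicit value at `0` of the cofactor. -/
theorem exists_wronskian_derivative_X_pow_mul {R : Type*} [CommRing R] {m n : ℕ}
    (hmn : 3 ≤ m + n) (A B : R[X]) :
    ∃ S : R[X],
      derivative (X ^ m * A) * derivative (derivative (X ^ n * B)) -
        derivative (derivative (X ^ m * A)) * derivative (X ^ n * B) = X ^ (m + n - 3) * S ∧
      S.coeff 0 = (m : R) * n * (n - m) * A.coeff 0 * B.coeff 0 := by
  have hA := X_mul_derivative_X_pow_mul m A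
  have hB := X_mul_derivative_X_pow_mul n B
  have hA' := congrArg (fun P => X * derivative P) hA
  have hB' := congrArg (fun P => X * derivative P) hB
  simp only [X_mul_derivative_X_pow_mul m (_ + _), X_mul_derivative_X_pow_mul n (_ + _),
    derivative_mul (f := X), derivative_X] at hA' hB'
  set A₁ := C (m : R) * A + X * derivative A with hA₁
  set B₁ := C (n : R) * B + X * derivative B with hB₁
  refine ⟨A₁ * (C (n : R) * B₁ + X * derivative B₁) -
    (C (m : R) * A₁ + X * derivative A₁) * B₁, ?_, ?_⟩
  · apply (isRegular_X_pow 3).left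
    simp only [← mul_assoc, ← pow_add, Nat.add_sub_cancel' hmn]
    generalize derivative (X ^ m * A) = P at *
    generalize derivative (X ^ n * B) = Q at *
    linear_combination (X * derivative Q + Q) * X * hA + X ^ m * A₁ * hB' -
      (X * derivative P + P) * X * hB - X ^ n * B₁ * hA'
  · simp only [hA₁, hB₁, coeff_sub, mul_coeff_zero, coeff_add, coeff_C_zero, coeff_X_zero]
    ring

end Polynomial



/-- Let `P₁`, `P₂` be linearly independent real polynomials vanishing at `0`
whose lowest-degree terms have the same degree `σ ≥ 1`, with lowest coefficients
`a_σ = P₁.coeff σ ≠ 0` and `b_σ = P₂.coeff σ ≠ 0`.  Let `ρ` be the degree of the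
lowest-degree term of the nonzero polynomial `P₂ − (b_σ/a_σ)·P₁` and `c_ρ` its coefficient.
Then `P₁′P₂″ − P₁″P₂′` is not identically zero; more precisely its lowest-degree term is
`σ·ρ·(ρ−σ)·a_σ·c_ρ·t^(σ+ρ−3)`. -/
theorem stmt10 (σ : ℕ) (hσ : 1 ≤ σ) (P₁ P₂ : Polynomial ℝ)
    (hind : ∀ a b : ℝ, a • P₁ + b • P₂ = 0 → a = 0 ∧ b = 0)
    (h01 : P₁.eval 0 = 0) (h02 : P₂.eval 0 = 0)
    (ht₁ : P₁.natTrailingDegree = σ) (ht₂ : P₂.natTrailingDegree = σ)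
    (ha : P₁.coeff σ ≠ 0) (hb : P₂.coeff σ ≠ 0)
    (ρ : ℕ)
    (hρ : (P₂ - Polynomial.C (P₂.coeff σ / P₁.coeff σ) * P₁).natTrailingDegree = ρ) :
    derivative P₁ * derivative (derivative P₂) -
      derivative (derivative P₁) * derivative P₂ ≠ 0 ∧
    (derivative P₁ * derivative (derivative P₂) -
      derivative (derivative P₁) * derivative P₂).natTrailingDegree = σ + ρ - 3 ∧
    (derivative P₁ * derivative (derivative P₂) -
      derivative (derivative P₁) * derivative P₂).coeff (σ + ρ - 3) =
      (σ : ℝ) * (ρ : ℝ) * ((ρ : ℝ) - (σ : ℝ)) * P₁.coeff σ *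
        (P₂ - Polynomial.C (P₂.coeff σ / P₁.coeff σ) * P₁).coeff ρ := by
  set k := P₂.coeff σ / P₁.coeff σ with hk
  set Q := P₂ - C k * P₁ with hQ
  have hQ0 : Q ≠ 0 := fun h => by
    have := (hind (-k) 1 (by rw [← h, hQ, smul_eq_C_mul, smul_eq_C_mul]; simp; ring)).2
    exact one_ne_zero this
  have hc : Q.coeff ρ ≠ 0 := by
    rw [← hρ]; exact trailingCoeff_nonzero_iff_nonzero.2 hQ0
  have hlt : σ < ρ := by
    by_contra! hle
    apply hc
    rcases hle.lt_or_eq with h | rfl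
    · simp [hQ, coeff_eq_zero_of_lt_natTrailingDegree (ht₁ ▸ h),
        coeff_eq_zero_of_lt_natTrailingDegree (ht₂ ▸ h)]
    · rw [hQ, coeff_sub, coeff_C_mul, hk, div_mul_cancel₀ _ ha, sub_self]
  obtain ⟨A, hA⟩ := exists_eq_X_pow_natTrailingDegree_mul P₁
  obtain ⟨B, hB⟩ := exists_eq_X_pow_natTrailingDegree_mul Q
  rw [ht₁] at hA
  rw [hρ] at hB
  have hA0 : P₁.coeff σ = A.coeff 0 := by
    rw [hA]; simpa using coeff_X_pow_mul A σ 0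
  have hB0 : Q.coeff ρ = B.coeff 0 := by
    rw [hB]; simpa using coeff_X_pow_mul B ρ 0
  obtain ⟨S, hS, hS0⟩ := exists_wronskian_derivative_X_pow_mul
    (show 3 ≤ σ + ρ by omega) A B
  rw [← hA, ← hB] at hS
  rw [← hA0, ← hB0] at hS0
  have hW : derivative P₁ * derivative (derivative P₂) -
      derivative (derivative P₁) * derivative P₂ = X ^ (σ + ρ - 3) * S := by
    rw [← hS, hQ]
    simp only [derivative_sub, derivative_C_mul]
    ring
  have hS0' : S.coeff 0 ≠ 0 := by
    rw [hS0]
    have h1 : (σ : ℝ) ≠ 0 := by positivity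
    have h2 : (ρ : ℝ) ≠ 0 := Nat.cast_ne_zero.2 (by omega)
    have h3 : (ρ : ℝ) - σ ≠ 0 := sub_ne_zero.2 (by exact_mod_cast hlt.ne')
    simp [h1, h2, h3, ha, hc]
  have hSne : S ≠ 0 := fun h => hS0' (by simp [h])
  rw [hW, ← hS0]
  refine ⟨mul_ne_zero (pow_ne_zero _ X_ne_zero) hSne, ?_, ?_⟩
  · rw [mul_comm, natTrailingDegree_mul_X_pow hSne, natTrailingDegree_eq_zero.2 (Or.inr hS0'),
      zero_add]
  · simpa using coeff_X_pow_mul S (σ + ρ - 3) 0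
end

section
/- Let σ ∈ (0, 1], let I ⊂ ℝ be a bounded interval, and let 𝔘 be a nonempty subset of L²(I) such that sup_{u ∈ 𝔘} ‖u‖_{L²(I)} < ∞. Say that f ∈ L²(I) is σ-uniform in 𝔘 if |∫_I f(x) · conj(u(x)) dx| ≤ σ‖f‖_{L²(I)} for all u ∈ 𝔘. Let ℒ : L²(I) → ℂ be a bounded sublinear functional, i.e. |ℒ(f + g)| ≤ |ℒ(f)| + |ℒ(g)| and |ℒ(c f)| = |c|·|ℒ(f)| for all f, g ∈ L²(I) and c ∈ ℂ, with sup_{‖f‖ ≤ 1} |ℒ(f)| < ∞. Define A_σ = sup{ |ℒ(f)| / ‖f‖_{L²(I)} : f is σ-uniform in 𝔘, f ≠ 0 } and M = sup_{u ∈ 𝔘} |ℒ(u)|. Then for every f ∈ L²(I), |ℒ(f)| ≤ max{A_σ, 2σ^{−1}M} · ‖f‖_{L²(I)}. -/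
open MeasureTheory

/-- If `f` correlates with `u` and `p u` is small, then splitting off the projection of `f` onto `u`
improves any global bound `p ≤ N ‖·‖` at `f`. -/
theorem Seminorm.le_improved_of_lt_norm_inner {E : Type*} [NormedAddCommGroup E]
    [InnerProductSpace ℂ E] (p : Seminorm ℂ E) {N K σ D : ℝ} (hσ : 0 < σ) (hD : 0 < D)
    (hKN : K ≤ N) (hp : ∀ f, p f ≤ N * ‖f‖) {u f : E} (huD : ‖u‖ ≤ D)
    (hu : 2 * p u ≤ σ * K) (huf : σ * ‖f‖ < ‖inner ℂ u f‖) :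
    p f ≤ (N - σ ^ 2 / (2 * D ^ 2) * (N - K)) * ‖f‖ := by
  have hu0 : u ≠ 0 := by
    rintro rfl
    rw [inner_zero_left, norm_zero] at huf
    exact absurd huf (not_lt.2 (by positivity))
  have hf0 : f ≠ 0 := by
    rintro rfl
    simp at huf
  have hs : 0 < ‖u‖ := norm_pos_iff.2 hu0
  have ha : 0 < ‖f‖ := norm_pos_iff.2 hf0
  set c : ℂ := inner ℂ u f / (‖u‖ : ℂ) ^ 2 with hc
  set g := f - c • u with hg
  have hfg : f = g + c • u := by simp [hg]
  have hug : inner ℂ u g = 0 := by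
    have : (‖u‖ : ℂ) ≠ 0 := by exact_mod_cast hs.ne'
    rw [hg, inner_sub_right, inner_smul_right, inner_self_eq_norm_sq_to_K, hc]
    simp only [Complex.coe_algebraMap]
    field_simp
    simp
  have hct : ‖c‖ * ‖u‖ ^ 2 = ‖inner ℂ u f‖ := by
    rw [hc, norm_div, norm_pow, Complex.norm_real, norm_norm]
    field_simp
  have hpyth : ‖f‖ ^ 2 = ‖g‖ ^ 2 + ‖c‖ ^ 2 * ‖u‖ ^ 2 := by
    have h := norm_add_sq_eq_norm_sq_add_norm_sq_of_inner_eq_zero (𝕜 := ℂ) g (c • u) (by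
      rw [inner_smul_right, ← inner_conj_symm, hug]; simp)
    rw [← hfg, norm_smul] at h
    linear_combination h
  have hpf : p f ≤ N * ‖g‖ + ‖c‖ * p u := by
    calc p f = p (g + c • u) := by rw [← hfg]
      _ ≤ p g + p (c • u) := map_add_le_add p _ _
      _ = p g + ‖c‖ * p u := by rw [map_smul_eq_mul]
      _ ≤ _ := by gcongr; exact hp g
  have hpu := apply_nonneg p u
  have hK : 0 ≤ K := by
    by_contra! h
    nlinarith
  have hN := hK.trans hKN
  rw [← hct] at huf
  set t := ‖c‖
  set s := ‖u‖
  set a := ‖f‖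
  set b := ‖g‖
  have ht : 0 ≤ t := norm_nonneg c
  have hb : b ≤ a - t ^ 2 * s ^ 2 / (2 * a) := by
    have : a - t ^ 2 * s ^ 2 / (2 * a) - b = (a - b) ^ 2 / (2 * a) := by
      field_simp
      linear_combination hpyth
    have : 0 ≤ (a - b) ^ 2 / (2 * a) := by positivity
    linarith
  have htu : t * p u ≤ K * (t ^ 2 * s ^ 2 / (2 * a)) := by
    have h : σ / 2 ≤ t * s ^ 2 / (2 * a) := by
      rw [div_le_div_iff₀ two_pos (by positivity)]
      linarith
    calc t * p u ≤ t * (K * (σ / 2)) := by gcongr; linarith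
      _ ≤ t * (K * (t * s ^ 2 / (2 * a))) := by gcongr
      _ = _ := by ring
  have hgain : σ ^ 2 / (2 * D ^ 2) * a ≤ t ^ 2 * s ^ 2 / (2 * a) := by
    have h : (σ * a) ^ 2 ≤ t ^ 2 * s ^ 2 * D ^ 2 := by
      calc (σ * a) ^ 2 ≤ (t * s ^ 2) ^ 2 := by gcongr
        _ = t ^ 2 * s ^ 2 * s ^ 2 := by ring
        _ ≤ _ := by gcongr
    rw [div_mul_eq_mul_div, div_le_div_iff₀ (by positivity) (by positivity)]
    nlinarith
  have h1 := mul_le_mul_of_nonneg_left hb hN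
  have h2 := mul_le_mul_of_nonneg_left hgain (sub_nonneg.2 hKN)
  linarith

/-- If `p f ≤ K ‖f‖` for every `f` that is `σ`-uniform in a bounded set `U`, and `p ≤ σ K / 2` on
`U`, then `p ≤ K ‖·‖` everywhere. -/
theorem Seminorm.le_mul_norm_of_uniform {E : Type*} [NormedAddCommGroup E]
    [InnerProductSpace ℂ E] (p : Seminorm ℂ E) {M₀ K σ D : ℝ} (hσ : σ ∈ Set.Ioc (0 : ℝ) 1)
    (hp : ∀ f, p f ≤ M₀ * ‖f‖) {U : Set E} (hUD : ∀ u ∈ U, ‖u‖ ≤ D)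
    (hU : ∀ u ∈ U, 2 * p u ≤ σ * K)
    (hunif : ∀ f, (∀ u ∈ U, ‖inner ℂ u f‖ ≤ σ * ‖f‖) → p f ≤ K * ‖f‖) (f : E) :
    p f ≤ K * ‖f‖ := by
  set S := {N : ℝ | K ≤ N ∧ ∀ f, p f ≤ N * ‖f‖} with hS
  have hbdd : BddBelow S := ⟨K, fun N hN => hN.1⟩
  have hne : S.Nonempty := ⟨max K M₀, le_max_left _ _, fun f => (hp f).trans (by
    gcongr; exact le_max_right _ _)⟩
  have hclosed : IsClosed S := by
    simp only [hS, Set.ofPred_and, Set.ofPred_forall]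
    exact isClosed_Ici.inter (isClosed_iInter fun f =>
      isClosed_le continuous_const (continuous_id.mul continuous_const))
  have hmem : sInf S ∈ S := hclosed.csInf_mem hne hbdd
  set N := sInf S
  set B := max D 1
  have hB : 1 ≤ B := le_max_right _ _
  set κ := σ ^ 2 / (2 * B ^ 2)
  have hσ0 : 0 < σ := hσ.1
  have hκ0 : 0 < κ := by positivity
  have hκ1 : κ ≤ 1 := by
    rw [div_le_one (by positivity)]
    nlinarith [hσ.2]
  have hKN : K ≤ N - κ * (N - K) := by nlinarith [hmem.1]
  have hle : N ≤ N - κ * (N - K) := by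
    refine csInf_le hbdd ⟨hKN, fun f => ?_⟩
    by_cases h : ∀ u ∈ U, ‖inner ℂ u f‖ ≤ σ * ‖f‖
    · exact (hunif f h).trans (by gcongr)
    · push Not at h
      obtain ⟨u, huU, huf⟩ := h
      exact p.le_improved_of_lt_norm_inner hσ0 (by positivity) hmem.1 hmem.2
        ((hUD u huU).trans (le_max_left _ _)) (hU u huU) huf
  have hNK : N = K := le_antisymm (by nlinarith) hmem.1
  exact hNK ▸ hmem.2 f

/-- the `σ`-uniformity lemma, Lemma B.1 of the paper, after Gowers and
Li.  Let `σ ∈ (0,1]`, `I ⊂ ℝ` a bounded interval, `𝔘` a nonempty subset of `L²(I)` with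
uniformly bounded norms, and `ℒ` a bounded sublinear functional on `L²(I)`.  With
`A_σ = sup{|ℒ(f)|/‖f‖ : f σ-uniform in 𝔘, f ≠ 0}` and `M = sup_{u ∈ 𝔘} |ℒ(u)|`, every
`f ∈ L²(I)` satisfies `|ℒ(f)| ≤ max{A_σ, 2σ⁻¹M}·‖f‖`. -/
theorem stmt16 (σ : ℝ) (hσ : σ ∈ Set.Ioc (0:ℝ) 1)
    (I : Set ℝ) (hIbd : Bornology.IsBounded I) (hIconn : I.OrdConnected)
    (𝔘 : Set (Lp ℂ 2 (volume.restrict I))) (h𝔘ne : 𝔘.Nonempty)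
    (h𝔘bd : ∃ D : ℝ, ∀ u ∈ 𝔘, ‖u‖ ≤ D)
    (ℒ : Lp ℂ 2 (volume.restrict I) → ℂ)
    (hadd : ∀ f g : Lp ℂ 2 (volume.restrict I), ‖ℒ (f + g)‖ ≤ ‖ℒ f‖ + ‖ℒ g‖)
    (hsmul : ∀ (c : ℂ) (f : Lp ℂ 2 (volume.restrict I)), ‖ℒ (c • f)‖ = ‖c‖ * ‖ℒ f‖)
    (hbdd : ∃ M₀ : ℝ, ∀ f : Lp ℂ 2 (volume.restrict I), ‖ℒ f‖ ≤ M₀ * ‖f‖) :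
    ∀ f : Lp ℂ 2 (volume.restrict I),
      ‖ℒ f‖ ≤
        max
          (sSup {r : ℝ | ∃ g : Lp ℂ 2 (volume.restrict I),
            (∀ u ∈ 𝔘,
              ‖∫ x, (g : ℝ → ℂ) x * (starRingEnd ℂ) ((u : ℝ → ℂ) x) ∂(volume.restrict I)‖
                ≤ σ * ‖g‖) ∧
            g ≠ 0 ∧ r = ‖ℒ g‖ / ‖g‖})
          (2 * σ⁻¹ * sSup ((fun u => ‖ℒ u‖) '' 𝔘)) * ‖f‖ := by
  obtain ⟨D, hD⟩ := h𝔘bd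
  obtain ⟨M₀, hM₀⟩ := hbdd
  have hσ0 : 0 < σ := hσ.1
  let p : Seminorm ℂ (Lp ℂ 2 (volume.restrict I)) := Seminorm.of (fun f => ‖ℒ f‖) hadd hsmul
  have hinner (u g : Lp ℂ 2 (volume.restrict I)) :
      ∫ x, (g : ℝ → ℂ) x * (starRingEnd ℂ) ((u : ℝ → ℂ) x) ∂(volume.restrict I)
        = inner ℂ u g := by
    simp only [L2.inner_def, RCLike.inner_apply]
  simp only [hinner]
  have hM (u) (hu : u ∈ 𝔘) : ‖ℒ u‖ ≤ sSup ((fun u => ‖ℒ u‖) '' 𝔘) := by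
    refine le_csSup ⟨max M₀ 0 * D, ?_⟩ ⟨u, hu, rfl⟩
    rintro _ ⟨v, hv, rfl⟩
    calc ‖ℒ v‖ ≤ M₀ * ‖v‖ := hM₀ v
      _ ≤ max M₀ 0 * ‖v‖ := by gcongr; exact le_max_left _ _
      _ ≤ max M₀ 0 * D := by gcongr; exact hD v hv
  refine p.le_mul_norm_of_uniform hσ hM₀ hD (fun u hu => ?_)
    fun g hg => ?_
  · calc 2 * ‖ℒ u‖ ≤ 2 * sSup ((fun u => ‖ℒ u‖) '' 𝔘) := by gcongr; exact hM u hu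
      _ = σ * (2 * σ⁻¹ * sSup ((fun u => ‖ℒ u‖) '' 𝔘)) := by field_simp
      _ ≤ _ := by gcongr; exact le_max_right _ _
  · rcases eq_or_ne g 0 with rfl | hg0
    · simp
    rw [← div_le_iff₀ (norm_pos_iff.2 hg0)]
    refine le_max_of_le_left (le_csSup ⟨M₀, ?_⟩ ⟨g, hg, hg0, rfl⟩)
    rintro _ ⟨v, -, hv0, rfl⟩
    exact (div_le_iff₀ (norm_pos_iff.2 hv0)).2 (hM₀ v)
end
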